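/- arXiv:0806.1461 — 5 statements merged into one kernel-verified Lean document; each statement's English description precedes it below -/
import Mathlib

section
/- Let K be a field, H a K-vector space, B a nondegenerate bilinear form on H, and N : H → H a K-linear endomorphism which is B-skew-adjoint, i.e. B(N u, v) = -B(u, N v) for all u, v ∈ H. Then the induced bilinear form B' on Im N determined by B'(N u, N v) = B(N u, v) is nondegenerate: if w ∈ Im N satisfies B'(w, z) = 0 for all z ∈ Im N then w = 0, and if z ∈ Im N satisfies B'(w, z) = 0 for all w ∈ Im N then z = 0. -/
/-- Let `K` be a field, `H` a `K`-vector space, `B` a nondegenerate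
bilinear form on `H`, and `N : H → H` a `K`-linear endomorphism which is `B`-skew-adjoint.
Then the induced bilinear form `B'` on `Im N` determined by `B' (N u) (N v) = B (N u) v`
is nondegenerate on both sides. -/
theorem induced_bilinear_form_on_range_nondegenerate
    {K H : Type*} [Field K] [AddCommGroup H] [Module K H]
    (B : H →ₗ[K] H →ₗ[K] K)
    (hB₁ : ∀ u : H, (∀ v : H, B u v = 0) → u = 0)
    (hB₂ : ∀ v : H, (∀ u : H, B u v = 0) → v = 0)
    (N : H →ₗ[K] H)
    (hN : ∀ u v : H, B (N u) v = - B u (N v))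
    (B' : ↥(LinearMap.range N) →ₗ[K] ↥(LinearMap.range N) →ₗ[K] K)
    (hB' : ∀ u v : H,
      B' ⟨N u, LinearMap.mem_range_self N u⟩ ⟨N v, LinearMap.mem_range_self N v⟩
        = B (N u) v) :
    (∀ w : ↥(LinearMap.range N), (∀ z : ↥(LinearMap.range N), B' w z = 0) → w = 0) ∧
    (∀ z : ↥(LinearMap.range N), (∀ w : ↥(LinearMap.range N), B' w z = 0) → z = 0) := by
  constructor
  · rintro ⟨_, u, rfl⟩ h
    refine Subtype.ext (hB₁ _ fun v => ?_)
    rw [← hB']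
    exact h _
  · rintro ⟨_, v, rfl⟩ h
    refine Subtype.ext (hB₂ _ fun u => ?_)
    rw [← neg_eq_zero, ← hN, ← hB']
    exact h _
end

section
/- Let K be a field, H a finite-dimensional K-vector space, B a nondegenerate bilinear form on H, and N_1, …, N_n : H → H K-linear endomorphisms such that N_i ∘ N_j = 0 for all i, j, and each N_i is B-skew-adjoint, i.e. B(N_i u, v) = -B(u, N_i v) for all u, v ∈ H. Consider the linear maps δ : H → ⊕_{i=1}^n Im N_i, δ(u) = (N_1 u, …, N_n u), and σ : ⊕_{i=1}^n Im N_i → H, σ(w_1, …, w_n) = Σ_{i=1}^n w_i. Then dim_K(ker σ) = dim_K((⊕_{i=1}^n Im N_i) / range δ). -/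
/-- Let `K` be a field, `H` a finite-dimensional `K`-vector space,
`B` a nondegenerate bilinear form on `H`, and `N 1, …, N n : H → H` linear endomorphisms
with `N i ∘ N j = 0` for all `i j` and each `N i` `B`-skew-adjoint. Let
`δ : H → ⊕ᵢ Im (N i)`, `δ u = (N 1 u, …, N n u)`, and `σ : ⊕ᵢ Im (N i) → H`,
`σ w = Σᵢ wᵢ`. Then `dim (ker σ) = dim ((⊕ᵢ Im (N i)) ⧸ range δ)`. -/
theorem finrank_ker_sum_eq_finrank_coker_diag
    {K H : Type*} [Field K] [AddCommGroup H] [Module K H] [FiniteDimensional K H]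
    (B : H →ₗ[K] H →ₗ[K] K)
    (hB₁ : ∀ u : H, (∀ v : H, B u v = 0) → u = 0)
    (hB₂ : ∀ v : H, (∀ u : H, B u v = 0) → v = 0)
    (n : ℕ) (N : Fin n → H →ₗ[K] H)
    (hNN : ∀ i j : Fin n, N i ∘ₗ N j = 0)
    (hskew : ∀ (i : Fin n) (u v : H), B (N i u) v = - B u (N i v))
    (δ : H →ₗ[K] ∀ i : Fin n, ↥(LinearMap.range (N i)))
    (hδ : ∀ (u : H) (i : Fin n), (δ u i : H) = N i u)
    (σ : (∀ i : Fin n, ↥(LinearMap.range (N i))) →ₗ[K] H)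
    (hσ : ∀ w : ∀ i : Fin n, ↥(LinearMap.range (N i)), σ w = ∑ i, (w i : H)) :
    Module.finrank K ↥(LinearMap.ker σ)
      = Module.finrank K
          ((∀ i : Fin n, ↥(LinearMap.range (N i))) ⧸ LinearMap.range δ) := by
  have hσ_mem : ∀ (i : Fin n) (v : H), N i v ∈ LinearMap.range σ := fun i v =>
    ⟨Pi.single i ⟨N i v, v, rfl⟩, by
      rw [hσ, Finset.sum_eq_single i]
      · simp
      · intro j _ hj
        simp [Pi.single_eq_of_ne hj]
      · simp⟩
  have hBinj : Function.Injective B := by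
    rw [injective_iff_map_eq_zero]
    intro u hu
    exact hB₁ u fun v => by rw [hu, LinearMap.zero_apply]
  let e : H ≃ₗ[K] Module.Dual K H :=
    LinearMap.linearEquivOfInjective B hBinj Subspace.dual_finrank_eq.symm
  have he : ∀ u, e u = B u := fun u => rfl
  have hker : (LinearMap.ker δ).map (e : H →ₗ[K] Module.Dual K H)
      = (LinearMap.range σ).dualAnnihilator := by
    ext f
    obtain ⟨u, rfl⟩ := e.surjective f
    rw [Submodule.mem_map_equiv, e.symm_apply_apply, LinearMap.mem_ker,
      Submodule.mem_dualAnnihilator, he]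
    constructor
    · rintro hu _ ⟨w, rfl⟩
      rw [hσ, map_sum]
      refine Finset.sum_eq_zero fun i _ => ?_
      obtain ⟨v, hv⟩ := (w i).2
      have hNu : N i u = 0 := by rw [← hδ, hu]; rfl
      have h := hskew i u v
      rw [hNu, map_zero, LinearMap.zero_apply] at h
      rw [← hv]
      exact neg_eq_zero.mp h.symm
    · intro h
      ext i
      rw [hδ]
      refine hB₁ _ fun v => ?_
      rw [hskew, h _ (hσ_mem i v), neg_zero]
  have h₁ := LinearEquiv.finrank_map_eq e (LinearMap.ker δ)
  rw [hker] at h₁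
  have h₂ := Subspace.finrank_add_finrank_dualAnnihilator_eq (LinearMap.range σ)
  have h₃ := δ.finrank_range_add_finrank_ker
  have h₄ := σ.finrank_range_add_finrank_ker
  have h₅ := (LinearMap.range δ).finrank_quotient_add_finrank
  omega
end

section
/- Let K be a field, H a finite-dimensional K-vector space, B a nondegenerate bilinear form on H, and N_1, …, N_n : H → H K-linear endomorphisms such that N_i ∘ N_j = 0 for all i, j, and each N_i is B-skew-adjoint, i.e. B(N_i u, v) = -B(u, N_i v) for all u, v ∈ H. Let B'_i be the induced nondegenerate bilinear form on Im N_i determined by B'_i(N_i u, N_i v) = B(N_i u, v), let δ : H → ⊕_{i=1}^n Im N_i be δ(u) = (N_1 u, …, N_n u), and let σ : ⊕_{i=1}^n Im N_i → H be σ(w_1, …, w_n) = Σ_i w_i. Then the bilinear map P : ker σ × ((⊕_{i=1}^n Im N_i) / range δ) → K given by P(w, [z]) = Σ_{i=1}^n B'_i(w_i, z_i) is well defined (independent of the representative z of the class [z]) and nondegenerate on both sides. -/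
/-- A bilinear form on a finite-dimensional space with trivial right kernel represents every
linear functional. -/
theorem LinearMap.exists_apply_eq_of_separatingRight {K H : Type*} [Field K] [AddCommGroup H]
    [Module K H] [FiniteDimensional K H] (B : H →ₗ[K] H →ₗ[K] K)
    (hB : ∀ v : H, (∀ u : H, B u v = 0) → v = 0) (f : H →ₗ[K] K) :
    ∃ v : H, ∀ u : H, B u v = f u := by
  have hinj : Function.Injective B.flip :=
    (injective_iff_map_eq_zero _).2 fun v hv => hB v fun u => LinearMap.congr_fun hv u
  obtain ⟨v, hv⟩ := (LinearMap.injective_iff_surjective_of_finrank_eq_finrank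
    (Subspace.dual_finrank_eq (K := K) (V := H)).symm).1 hinj f
  exact ⟨v, fun u => LinearMap.congr_fun hv u⟩

/-- With `K`, `H`, `B`, `N i`, `δ`, `σ` as in Statement 3, and with
`B' i` the induced bilinear form on `Im (N i)` determined by
`B' i (N i u) (N i v) = B (N i u) v`, the pairing
`P : ker σ × ((⊕ᵢ Im (N i)) ⧸ range δ) → K`, `P (w, [z]) = Σᵢ B' i wᵢ zᵢ`,
is well defined (independent of the representative `z`) and nondegenerate on both
sides (nondegeneracy in the second argument means: if `Σᵢ B' i wᵢ zᵢ = 0` for all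
`w ∈ ker σ` then `z ∈ range δ`, i.e. `[z] = 0`). -/
theorem pairing_ker_sum_coker_diag_wellDefined_nondegenerate
    {K H : Type*} [Field K] [AddCommGroup H] [Module K H] [FiniteDimensional K H]
    (B : H →ₗ[K] H →ₗ[K] K)
    (hB₁ : ∀ u : H, (∀ v : H, B u v = 0) → u = 0)
    (hB₂ : ∀ v : H, (∀ u : H, B u v = 0) → v = 0)
    (n : ℕ) (N : Fin n → H →ₗ[K] H)
    (hNN : ∀ i j : Fin n, N i ∘ₗ N j = 0)
    (hskew : ∀ (i : Fin n) (u v : H), B (N i u) v = - B u (N i v))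
    (B' : ∀ i : Fin n,
      ↥(LinearMap.range (N i)) →ₗ[K] ↥(LinearMap.range (N i)) →ₗ[K] K)
    (hB' : ∀ (i : Fin n) (u v : H),
      B' i ⟨N i u, LinearMap.mem_range_self (N i) u⟩
           ⟨N i v, LinearMap.mem_range_self (N i) v⟩ = B (N i u) v)
    (δ : H →ₗ[K] ∀ i : Fin n, ↥(LinearMap.range (N i)))
    (hδ : ∀ (u : H) (i : Fin n), (δ u i : H) = N i u)
    (σ : (∀ i : Fin n, ↥(LinearMap.range (N i))) →ₗ[K] H)
    (hσ : ∀ w : ∀ i : Fin n, ↥(LinearMap.range (N i)), σ w = ∑ i, (w i : H)) :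
    -- well-definedness: the pairing only depends on the class of `z` modulo `range δ`
    (∀ w ∈ LinearMap.ker σ, ∀ z z' : ∀ i : Fin n, ↥(LinearMap.range (N i)),
        z - z' ∈ LinearMap.range δ →
        ∑ i, B' i (w i) (z i) = ∑ i, B' i (w i) (z' i)) ∧
    -- nondegeneracy in the first argument
    (∀ w ∈ LinearMap.ker σ,
        (∀ z : ∀ i : Fin n, ↥(LinearMap.range (N i)),
          ∑ i, B' i (w i) (z i) = 0) → w = 0) ∧
    -- nondegeneracy in the second argument
    (∀ z : ∀ i : Fin n, ↥(LinearMap.range (N i)),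
        (∀ w ∈ LinearMap.ker σ, ∑ i, B' i (w i) (z i) = 0) →
        z ∈ LinearMap.range δ) := by
  have hB'_apply (i : Fin n) (w : LinearMap.range (N i)) (v : H) :
      B' i w ⟨N i v, LinearMap.mem_range_self (N i) v⟩ = B w v := by
    obtain ⟨_, u, rfl⟩ := w
    exact hB' i u v
  have hδ_apply (v : H) (i : Fin n) :
      δ v i = ⟨N i v, LinearMap.mem_range_self (N i) v⟩ := Subtype.ext (hδ v i)
  have hadj (w : ∀ i : Fin n, LinearMap.range (N i)) (v : H) :
      ∑ i, B' i (w i) (δ v i) = B (σ w) v := by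
    simp [hδ_apply, hB'_apply, hσ]
  refine ⟨?_, ?_, ?_⟩
  · rintro w hw z z' ⟨v, hv⟩
    rw [← sub_eq_zero, ← Finset.sum_sub_distrib]
    calc ∑ i, (B' i (w i) (z i) - B' i (w i) (z' i))
        = ∑ i, B' i (w i) (δ v i) := by simp [hv]
      _ = 0 := by rw [hadj, LinearMap.mem_ker.1 hw, map_zero, LinearMap.zero_apply]
  · intro w _ h
    ext i
    refine hB₁ _ fun v => ?_
    rw [← hB'_apply]
    have hi := h (Pi.single i ⟨N i v, LinearMap.mem_range_self (N i) v⟩)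
    rwa [Finset.sum_eq_single i (fun j _ hj => by simp [hj]) (by simp), Pi.single_eq_same] at hi
  · intro z h
    let φ : (∀ i : Fin n, LinearMap.range (N i)) →ₗ[K] K :=
      ∑ i, (B' i).flip (z i) ∘ₗ LinearMap.proj i
    have hφ (w) : φ w = ∑ i, B' i (w i) (z i) := by simp [φ]
    have hmem : φ ∈ LinearMap.range σ.dualMap := by
      rw [LinearMap.range_dualMap_eq_dualAnnihilator_ker, Submodule.mem_dualAnnihilator]
      intro w hw
      rw [hφ, h w hw]
    obtain ⟨f, hf⟩ := hmem
    obtain ⟨v, hv⟩ := B.exists_apply_eq_of_separatingRight hB₂ f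
    have hsum (w : ∀ i : Fin n, LinearMap.range (N i)) :
        ∑ i, B' i (w i) (δ v i) = ∑ i, B' i (w i) (z i) := by
      rw [hadj, hv, ← hφ, ← hf, LinearMap.dualMap_apply]
    refine ⟨v, funext fun i => ?_⟩
    obtain ⟨x, hx⟩ := (z i).2
    have hzi : z i = ⟨N i x, LinearMap.mem_range_self (N i) x⟩ := Subtype.ext hx.symm
    have hNi : N i (v - x) = 0 := hB₂ _ fun u => by
      have hi := hsum (Pi.single i ⟨N i u, LinearMap.mem_range_self (N i) u⟩)
      rw [Finset.sum_eq_single i (fun j _ hj => by simp [hj]) (by simp),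
        Finset.sum_eq_single i (fun j _ hj => by simp [hj]) (by simp), Pi.single_eq_same,
        hδ_apply, hzi, hB', hB', ← sub_eq_zero, ← map_sub, hskew] at hi
      exact neg_eq_zero.1 hi
    rw [hδ_apply, hzi]
    exact Subtype.ext (sub_eq_zero.1 (by rwa [map_sub] at hNi))
end

section
/- Let m be a natural number and g a polynomial in m variables over ℂ (an element of MvPolynomial (Fin m) ℂ). Then the set of critical values of g, namely { c ∈ ℂ : there exists x : Fin m → ℂ with eval x (pderiv i g) = 0 for every i and eval x g = c }, is a finite subset of ℂ. -/
open MvPolynomial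

/-- If `B` is formally smooth over `A`, then the map `B ⊗[A] Ω[A⁄R] → Ω[B⁄R]` is injective. -/
theorem KaehlerDifferential.mapBaseChange_injective_of_formallySmooth (R A B : Type*)
    [CommRing R] [CommRing A] [CommRing B] [Algebra R A] [Algebra A B] [Algebra R B]
    [IsScalarTower R A B] [Algebra.FormallySmooth A B] :
    Function.Injective (KaehlerDifferential.mapBaseChange R A B) := by
  rw [injective_iff_map_eq_zero]
  intro x hx
  obtain ⟨y, rfl⟩ := (Algebra.H1Cotangent.exact_δ_mapBaseChange R A B x).mp hx
  rw [Subsingleton.elim y 0, map_zero]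

/-- In an essentially finitely generated field extension of characteristic zero, an element whose
differential vanishes is algebraic over the base field. -/
theorem KaehlerDifferential.isAlgebraic_of_D_eq_zero {k K : Type*} [Field k] [CharZero k]
    [Field K] [Algebra k K] [Algebra.EssFiniteType k K] {t : K}
    (ht : KaehlerDifferential.D k K t = 0) : IsAlgebraic k t := by
  by_contra htr
  replace htr : Transcendental k t := htr
  let := (Polynomial.aeval (R := k) t).toAlgebra
  have htower : IsScalarTower k (Polynomial k) K :=
    .of_algebraMap_eq fun r ↦ (Polynomial.aeval_C t r).symm
  have : FaithfulSMul (Polynomial k) K := (faithfulSMul_iff_algebraMap_injective _ _).mpr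
    (transcendental_iff_injective.mp htr)
  let := FractionRing.liftAlgebra (Polynomial k) K
  have := FractionRing.isScalarTower_liftAlgebra (Polynomial k) K
  have : IsScalarTower k (FractionRing (Polynomial k)) K := .to₁₃₄ k (Polynomial k) _ K
  have : Algebra.EssFiniteType (FractionRing (Polynomial k)) K :=
    .of_comp k (FractionRing (Polynomial k)) K
  have : CharZero (FractionRing (Polynomial k)) :=
    charZero_of_injective_algebraMap (algebraMap k (FractionRing (Polynomial k))).injective
  have : Algebra.FormallySmooth (Polynomial k) (FractionRing (Polynomial k)) :=
    .of_isLocalization (nonZeroDivisors _)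
  have : Algebra.FormallySmooth (Polynomial k) K := .comp _ (FractionRing (Polynomial k)) _
  have hX : algebraMap (Polynomial k) K Polynomial.X = t := Polynomial.aeval_X t
  have h : (1 : K) ⊗ₜ[Polynomial k] KaehlerDifferential.D k (Polynomial k) Polynomial.X = 0 :=
    mapBaseChange_injective_of_formallySmooth k (Polynomial k) K (by simp [hX, ht])
  simpa using congr((TensorProduct.rid (Polynomial k) K)
    ((KaehlerDifferential.polynomialEquiv k).toLinearMap.lTensor K $h))

/-- If all partial derivatives of `g` lie in a prime ideal `P`, then `g` is constant modulo `P`. -/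
theorem MvPolynomial.exists_sub_C_mem_of_pderiv_mem {σ k : Type*} [Finite σ] [Field k]
    [CharZero k] [IsAlgClosed k] (g : MvPolynomial σ k) (P : Ideal (MvPolynomial σ k)) [P.IsPrime]
    (hP : ∀ i, pderiv i g ∈ P) : ∃ c : k, g - C c ∈ P := by
  have := Fintype.ofFinite σ
  have hD : KaehlerDifferential.D k P.ResidueField (algebraMap _ P.ResidueField g) = 0 := by
    rw [← KaehlerDifferential.map_D k k (MvPolynomial σ k),
      ← (KaehlerDifferential.mvPolynomialBasis k σ).sum_repr (KaehlerDifferential.D _ _ g),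
      map_sum]
    refine Finset.sum_eq_zero fun i _ ↦ ?_
    rw [map_smul, KaehlerDifferential.mvPolynomialBasis_repr_apply, algebra_compatible_smul
      P.ResidueField, Ideal.algebraMap_residueField_eq_zero.mpr (hP i), zero_smul]
  have : Algebra.EssFiniteType k P.ResidueField := .comp k (MvPolynomial σ k) P.ResidueField
  have hg := (KaehlerDifferential.isAlgebraic_of_D_eq_zero hD).isIntegral
  obtain ⟨c, hc⟩ := minpoly.mem_range_of_degree_eq_one k _
    (IsAlgClosed.degree_eq_one_of_irreducible k (minpoly.irreducible hg))
  refine ⟨c, ?_⟩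
  rw [← Ideal.algebraMap_residueField_eq_zero, map_sub, ← hc, ← algebraMap_eq,
    ← IsScalarTower.algebraMap_apply, sub_self]

/-- For a polynomial `g` in `m` variables over `ℂ`, the set of critical
values of `g` — the set of `c : ℂ` such that `c = g x` for some point `x` at which all
formal partial derivatives of `g` vanish — is finite. -/
theorem finite_critical_values (m : ℕ) (g : MvPolynomial (Fin m) ℂ) :
    {c : ℂ | ∃ x : Fin m → ℂ,
      (∀ i : Fin m, eval x (pderiv i g) = 0) ∧ eval x g = c}.Finite := by
  let I := Ideal.span (Set.range fun i ↦ pderiv i g)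
  have key (P : I.minimalPrimes) : ∃ c : ℂ, g - C c ∈ P.1 := by
    have : P.1.IsPrime := P.2.1.1
    exact g.exists_sub_C_mem_of_pderiv_mem P.1
      fun i ↦ P.2.1.2 (Ideal.subset_span (Set.mem_range_self i))
  choose c hc using key
  have : Finite I.minimalPrimes := I.finite_minimalPrimes_of_isNoetherianRing
  refine (Set.finite_range c).subset ?_
  rintro _ ⟨x, hx, rfl⟩
  have hI : I ≤ RingHom.ker (eval x) := Ideal.span_le.mpr (Set.range_subset_iff.mpr hx)
  have : (RingHom.ker (eval x)).IsPrime := RingHom.ker_isPrime _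
  obtain ⟨P, hP, hPx⟩ := Ideal.exists_minimalPrimes_le hI
  refine ⟨⟨P, hP⟩, ?_⟩
  have h := hPx (hc ⟨P, hP⟩)
  rw [RingHom.mem_ker, map_sub, eval_C, sub_eq_zero] at h
  exact h.symm
end

section
/- Let m and d be natural numbers with d ≥ 1, and let g be a polynomial in m variables over ℂ of total degree at most d, with homogeneous components g_i, and let G = Σ_{i=0}^{d} g_i · z^{d-i} be the degree-d homogenization of g in m+1 variables with new variable z. Assume that for every nonzero x : Fin m → ℂ at which all m partial derivatives of g_d vanish, one has g_{d-1}(x) ≠ 0. Then there is no nonzero x : Fin m → ℂ such that all m+1 partial derivatives of G vanish at the point x̂ ∈ ℂ^{m+1} obtained from x by setting the z-coordinate to 0. In other words, the projective hypersurface defined by G is smooth along its intersection with the hyperplane at infinity {z = 0}. -/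
open MvPolynomial

/-- The degree-`d` homogenization of a polynomial `g` in `m` variables:
`G = Σ_{i=0}^{d} g_i · z^{d-i}`, where `g_i` is the degree-`i` homogeneous component
of `g` (regarded as a polynomial in the first `m` of `m+1` variables) and
`z = X (Fin.last m)` is the new variable. -/
noncomputable def homogenization (m d : ℕ) (g : MvPolynomial (Fin m) ℂ) :
    MvPolynomial (Fin (m + 1)) ℂ :=
  ∑ i ∈ Finset.range (d + 1),
    (rename (Fin.castSucc : Fin m → Fin (m + 1)) (homogeneousComponent i g))
      * (X (Fin.last m)) ^ (d - i)

theorem eval_snoc_rename_castSucc {m : ℕ} (x : Fin m → ℂ) (a : ℂ) (p : MvPolynomial (Fin m) ℂ) :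
    eval (Fin.snoc x a : Fin (m + 1) → ℂ) (rename Fin.castSucc p) = eval x p := by
  rw [eval_rename]
  congr 2
  funext i
  simp

theorem pderiv_last_rename_castSucc {m : ℕ} (p : MvPolynomial (Fin m) ℂ) :
    pderiv (Fin.last m) (rename Fin.castSucc p) = 0 := by
  classical
  refine pderiv_eq_zero_of_notMem_vars fun h => ?_
  obtain ⟨i, -, hi⟩ := Finset.mem_image.mp (vars_rename _ _ h)
  exact (Fin.castSucc_lt_last i).ne hi

theorem eval_pderiv_castSucc_homogenization {m : ℕ} (d : ℕ) (g : MvPolynomial (Fin m) ℂ)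
    (x : Fin m → ℂ) (j : Fin m) :
    eval (Fin.snoc x (0 : ℂ)) (pderiv j.castSucc (homogenization m d g)) =
      eval x (pderiv j (homogeneousComponent d g)) := by
  have hj : Fin.last m ≠ j.castSucc := (Fin.castSucc_lt_last j).ne'
  rw [homogenization, map_sum, map_sum, Finset.sum_eq_single d]
  · simp [pderiv_rename (Fin.castSucc_injective m), eval_snoc_rename_castSucc]
  · intro i hi hid
    have hne : d - i ≠ 0 := by
      have := Finset.mem_range.mp hi
      omega
    simp [pderiv_X_of_ne hj, hne]
  · simp

theorem eval_pderiv_last_homogenization {m d : ℕ} (hd : 1 ≤ d) (g : MvPolynomial (Fin m) ℂ)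
    (x : Fin m → ℂ) :
    eval (Fin.snoc x (0 : ℂ)) (pderiv (Fin.last m) (homogenization m d g)) =
      eval x (homogeneousComponent (d - 1) g) := by
  rw [homogenization, map_sum, map_sum, Finset.sum_eq_single (d - 1)]
  · simp [pderiv_last_rename_castSucc, eval_snoc_rename_castSucc, Nat.sub_sub_self hd]
  · intro i hi hid
    obtain rfl | hne : i = d ∨ d - i - 1 ≠ 0 := by
      have := Finset.mem_range.mp hi
      omega
    · simp [pderiv_last_rename_castSucc]
    · simp [pderiv_last_rename_castSucc, hne]
  · intro h
    exact absurd (Finset.mem_range.mpr (by omega)) h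

/-- Let `g` be a polynomial in `m` variables over `ℂ` of total degree at
most `d` (with `d ≥ 1`) and `G` its degree-`d` homogenization. Assume that for every
nonzero `x : Fin m → ℂ` at which all partial derivatives of the top component `g_d`
vanish, one has `g_{d-1}(x) ≠ 0`. Then there is no nonzero `x : Fin m → ℂ` such that all
`m+1` partial derivatives of `G` vanish at `x̂ = Fin.snoc x 0`; i.e. the projective
hypersurface `{G = 0}` is smooth along the hyperplane at infinity `{z = 0}`. -/
theorem homogenization_smooth_at_infinity
    (m d : ℕ) (hd : 1 ≤ d) (g : MvPolynomial (Fin m) ℂ)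
    (hdeg : g.totalDegree ≤ d)
    (hsing : ∀ x : Fin m → ℂ, x ≠ 0 →
      (∀ j : Fin m, eval x (pderiv j (homogeneousComponent d g)) = 0) →
      eval x (homogeneousComponent (d - 1) g) ≠ 0) :
    ¬ ∃ x : Fin m → ℂ, x ≠ 0 ∧
      ∀ k : Fin (m + 1),
        eval (Fin.snoc x (0 : ℂ)) (pderiv k (homogenization m d g)) = 0 := by
  rintro ⟨x, hx, h⟩
  refine hsing x hx (fun j => ?_) ?_
  · rw [← eval_pderiv_castSucc_homogenization, h]
  · rw [← eval_pderiv_last_homogenization hd, h]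
end
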